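/- arXiv:0907.3497 — 4 statements merged into one kernel-verified Lean document; each statement's English description precedes it below -/
import Mathlib

section
/- None of the six graphs K4, W5, S1, S2, T, B (the members of the family 𝔊) is 3-colorable. -/
open SimpleGraph

/-- Build a simple graph on `Fin n` from a list of edges (symmetrized, loops removed). -/
def graphOfList {n : ℕ} (l : List (Fin n × Fin n)) : SimpleGraph (Fin n) :=
  SimpleGraph.fromRel (fun a b => (a, b) ∈ l)

/-- `K4`: the complete graph on four vertices. -/
def graphK4 : SimpleGraph (Fin 4) := ⊤

/-- `W5`: a 5-cycle `0,1,2,3,4` plus a hub `5` adjacent to all cycle vertices. -/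
def graphW5 : SimpleGraph (Fin 6) :=
  graphOfList [(0,1),(1,2),(2,3),(3,4),(4,0),(5,0),(5,1),(5,2),(5,3),(5,4)]

/-- `S1`: 5-cycle `v1..v5 = 0..4`, `u2 = 5` adjacent exactly to `v1,v2,v3`,
`u5 = 6` adjacent exactly to `v1,v4,v5`. -/
def graphS1 : SimpleGraph (Fin 7) :=
  graphOfList [(0,1),(1,2),(2,3),(3,4),(4,0),(5,0),(5,1),(5,2),(6,0),(6,3),(6,4)]

/-- `S2`: 5-cycle `v1..v5 = 0..4`, `w = 5` adjacent exactly to `v2,v3,v4,v5`,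
`x = 6` adjacent exactly to `v1,v3,v4`. -/
def graphS2 : SimpleGraph (Fin 7) :=
  graphOfList [(0,1),(1,2),(2,3),(3,4),(4,0),(5,1),(5,2),(5,3),(5,4),(6,0),(6,2),(6,3)]

/-- `T`: vertices `u1,uA,uB,u2 = 0,1,2,3`, `w1,wA,wB,w2 = 4,5,6,7`, `x1,x2 = 8,9`. -/
def graphT : SimpleGraph (Fin 10) :=
  graphOfList [(0,1),(0,2),(1,2),(1,3),(2,3),
               (4,5),(4,6),(5,6),(5,7),(6,7),
               (0,4),(0,7),(3,4),(3,7),(1,5),(2,6),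
               (8,0),(8,2),(8,4),(8,5),(8,9),
               (9,1),(9,3),(9,6),(9,7)]

/-- `B`: vertices `w = 0`, `u0..u5 = 1..6`, `v0..v5 = 7..12`, with its 39 edges. -/
def graphB : SimpleGraph (Fin 13) :=
  graphOfList [(0,2),(0,3),(0,6),(0,8),(0,9),(0,12),
               (1,2),(1,3),(1,4),(1,6),(1,8),(1,12),
               (2,3),(2,4),(2,5),(2,7),
               (3,9),(3,10),(3,11),
               (4,6),(4,9),(4,10),(4,11),
               (5,6),(5,9),(5,10),(5,11),(5,12),
               (6,7),(6,11),
               (7,8),(7,9),(7,10),(7,12),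
               (8,9),(8,10),(8,11),
               (10,12),(11,12)]

/-- `G` contains an induced copy of the path `P5` on five vertices. -/
def HasInducedP5 {V : Type*} (G : SimpleGraph V) : Prop :=
  ∃ f : Fin 5 ↪ V, ∀ a b : Fin 5, (SimpleGraph.pathGraph 5).Adj a b ↔ G.Adj (f a) (f b)

/-- `G` is `P5`-free: it has no induced subgraph isomorphic to `P5`. -/
def P5Free {V : Type*} (G : SimpleGraph V) : Prop := ¬ HasInducedP5 G

/-- `G` is an MN3P5 graph: `P5`-free, not 3-colorable, and every proper subgraph
is 3-colorable or contains an induced `P5`. -/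
def IsMN3P5 {V : Type*} (G : SimpleGraph V) : Prop :=
  P5Free G ∧ ¬ G.Colorable 3 ∧
  ∀ H : G.Subgraph, H ≠ ⊤ → (H.coe.Colorable 3 ∨ HasInducedP5 H.coe)

/-- `G` is isomorphic to one of the six graphs `K4, W5, S1, S2, T, B`. -/
def IsoToSix {V : Type*} (G : SimpleGraph V) : Prop :=
  Nonempty (G ≃g graphK4) ∨ Nonempty (G ≃g graphW5) ∨ Nonempty (G ≃g graphS1) ∨
  Nonempty (G ≃g graphS2) ∨ Nonempty (G ≃g graphT) ∨ Nonempty (G ≃g graphB)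

/-- `v` traces a 5-hole (an induced 5-cycle) in `G`. -/
def IsFiveHole {V : Type*} (G : SimpleGraph V) (v : Fin 5 → V) : Prop :=
  Function.Injective v ∧ ∀ i j : Fin 5, G.Adj (v i) (v j) ↔ (j = i + 1 ∨ i = j + 1)

/-- `{a, b, c}` is a dominating clique of size 3 in `G`. -/
def IsDomClique3 {V : Type*} (G : SimpleGraph V) (a b c : V) : Prop :=
  a ≠ b ∧ a ≠ c ∧ b ≠ c ∧ G.Adj a b ∧ G.Adj a c ∧ G.Adj b c ∧
  ∀ x : V, x ≠ a → x ≠ b → x ≠ c → (G.Adj x a ∨ G.Adj x b ∨ G.Adj x c)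

/-- `H` is a subgraph of `G` (deleting vertices and edges): there is an injection of
vertices carrying edges to edges. -/
def ContainsSub {V W : Type*} (G : SimpleGraph V) (H : SimpleGraph W) : Prop :=
  ∃ f : W ↪ V, ∀ a b : W, H.Adj a b → G.Adj (f a) (f b)

/-- `G` is minimally non-`k`-colorable: not `k`-colorable, but every proper subgraph is. -/
def MinNonColorable {V : Type*} (k : ℕ) (G : SimpleGraph V) : Prop :=
  ¬ G.Colorable k ∧ ∀ H : G.Subgraph, H ≠ ⊤ → H.coe.Colorable k


/-- A proper colouring of `graphOfList l` separates the ends of every listed edge. -/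
lemma graphOfList_coloring_ne {n : ℕ} {α : Type*} {l : List (Fin n × Fin n)}
    (c : (graphOfList l).Coloring α) :
    ∀ p ∈ l, p.1 ≠ p.2 → c p.1 ≠ c p.2 := fun _ hp hne =>
  c.valid ((SimpleGraph.fromRel_adj _ _ _).2 ⟨hne, Or.inl hp⟩)

theorem six_graphs_not_three_colorable :
    ¬ graphK4.Colorable 3 ∧ ¬ graphW5.Colorable 3 ∧ ¬ graphS1.Colorable 3 ∧
    ¬ graphS2.Colorable 3 ∧ ¬ graphT.Colorable 3 ∧ ¬ graphB.Colorable 3 := by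
  refine ⟨fun ⟨c⟩ => ?_, fun ⟨c⟩ => ?_, fun ⟨c⟩ => ?_,
    fun ⟨c⟩ => ?_, fun ⟨c⟩ => ?_, fun ⟨c⟩ => ?_⟩
  · simpa using Fintype.card_le_of_injective c (SimpleGraph.Hom.injective_of_top_hom c)
  all_goals
    have h := graphOfList_coloring_ne c
    simp only [List.forall_mem_cons, List.not_mem_nil, false_imp_iff, implies_true, and_true] at h
    norm_num [Fin.ext_iff] at h
    grind
end

section
/- Let G be an MN3P5 graph containing a 5-hole C on vertices v1,v2,v3,v4,v5 and a vertex w (not on C) adjacent to at least 4 vertices of C. Then G is isomorphic to one of the six graphs K4, W5, S1, S2, T, B (the members of the family 𝔊). -/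
open SimpleGraph

section Criticality

variable {V W : Type*} {G : SimpleGraph V} {H : SimpleGraph W}

instance graphOfList_decidableRel {n : ℕ} (l : List (Fin n × Fin n)) :
    DecidableRel (graphOfList l).Adj :=
  fun a b => inferInstanceAs (Decidable (a ≠ b ∧ ((a, b) ∈ l ∨ (b, a) ∈ l)))

/-- Distinct vertices of `P5` have distinct neighbourhoods, so a map inducing `P5` is injective. -/
theorem hasInducedP5_of_adj_iff (f : Fin 5 → V)
    (hf : ∀ a b, (pathGraph 5).Adj a b ↔ G.Adj (f a) (f b)) : HasInducedP5 G := by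
  refine ⟨⟨f, fun a b hab => ?_⟩, hf⟩
  have h : ∀ c, (pathGraph 5).Adj a c ↔ (pathGraph 5).Adj b c := fun c => by
    rw [hf, hf, hab]
  simp only [pathGraph_adj] at h
  clear hab hf
  revert a b
  decide

theorem hasInducedP5_of_path {a b c d e : V} (hab : G.Adj a b) (hbc : G.Adj b c)
    (hcd : G.Adj c d) (hde : G.Adj d e) (hac : ¬ G.Adj a c) (had : ¬ G.Adj a d)
    (hae : ¬ G.Adj a e) (hbd : ¬ G.Adj b d) (hbe : ¬ G.Adj b e) (hce : ¬ G.Adj c e) :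
    HasInducedP5 G := by
  refine hasInducedP5_of_adj_iff ![a, b, c, d, e] fun i j => ?_
  fin_cases i <;> fin_cases j <;> simp [pathGraph_adj, G.adj_comm, *]

theorem HasInducedP5.of_embedding (h : HasInducedP5 H) (e : H ↪g G) : HasInducedP5 G := by
  obtain ⟨f, hf⟩ := h
  exact ⟨f.trans e.toEmbedding, fun a b => (hf a b).trans e.map_adj_iff.symm⟩

theorem p5Free_of_forall
    (h : ∀ a b, G.Adj a b → ∀ c, G.Adj b c → ¬ G.Adj a c → ∀ d, G.Adj c d → ¬ G.Adj a d →
      ¬ G.Adj b d → ∀ e, G.Adj d e → ¬ G.Adj a e → ¬ G.Adj b e → G.Adj c e) : P5Free G := by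
  rintro ⟨f, hf⟩
  have key := h (f 0) (f 1)
  have := key ((hf 0 1).1 (by simp [pathGraph_adj])) (f 2) ((hf 1 2).1 (by simp [pathGraph_adj]))
    (mt (hf 0 2).2 (by simp [pathGraph_adj])) (f 3) ((hf 2 3).1 (by simp [pathGraph_adj]))
    (mt (hf 0 3).2 (by simp [pathGraph_adj])) (mt (hf 1 3).2 (by simp [pathGraph_adj])) (f 4)
    ((hf 3 4).1 (by simp [pathGraph_adj])) (mt (hf 0 4).2 (by simp [pathGraph_adj]))
    (mt (hf 1 4).2 (by simp [pathGraph_adj]))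
  exact absurd ((hf 2 4).2 this) (by simp [pathGraph_adj])

/-- An MN3P5 graph is isomorphic to any `P5`-free non-3-colorable graph that it contains. -/
theorem IsMN3P5.nonempty_iso (hG : IsMN3P5 G) (hP : P5Free H) (hc : ¬ H.Colorable 3)
    (hs : ContainsSub G H) : Nonempty (G ≃g H) := by
  obtain ⟨f, hf⟩ := hs
  let φ : Copy H G := ⟨⟨f, fun {a b} h => hf a b h⟩, f.injective⟩
  have htop : φ.toSubgraph = ⊤ := by
    by_contra hne
    rcases hG.2.2 _ hne with h | h
    · exact hc (h.of_hom φ.isoToSubgraph.toHom)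
    · exact hP (h.of_embedding φ.isoToSubgraph.symm.toEmbedding)
  have e := φ.isoToSubgraph
  rw [htop] at e
  exact ⟨(e.trans Subgraph.topIso).symm⟩

/-- In an MN3P5 graph no neighbourhood of a vertex is contained in that of another vertex. -/
theorem IsMN3P5.exists_adj_not_adj (hG : IsMN3P5 G) {a b : V} (hab : a ≠ b) :
    ∃ x, G.Adj a x ∧ ¬ G.Adj b x := by
  by_contra! hsub
  let K : G.Subgraph := (⊤ : G.Subgraph).induce {a}ᶜ
  have hK : K ≠ ⊤ := fun h => by
    have : a ∈ K.verts := h ▸ Set.mem_univ a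
    exact this rfl
  rcases hG.2.2 K hK with ⟨⟨c⟩⟩ | h
  · classical
    refine hG.2.1 ⟨Coloring.mk (fun y => if h : y = a then c ⟨b, hab.symm⟩ else c ⟨y, h⟩) ?_⟩
    intro y z hyz
    by_cases hy : y = a <;> by_cases hz : z = a
    · exact absurd (hy.trans hz.symm) hyz.ne
    · subst hy
      simpa [hz] using c.valid (v := ⟨b, hab.symm⟩) (w := ⟨z, hz⟩)
        (show K.Adj b z from ⟨hab.symm, hz, hsub z hyz⟩)
    · subst hz
      simpa [hy] using c.valid (v := ⟨y, hy⟩) (w := ⟨b, hab.symm⟩)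
        (show K.Adj y b from ⟨hy, hab.symm, (hsub y hyz.symm).symm⟩)
    · simpa [hy, hz] using c.valid (v := ⟨y, hy⟩) (w := ⟨z, hz⟩)
        (show K.Adj y z from ⟨hy, hz, hyz⟩)
  · refine hG.1 (h.of_embedding ⟨⟨Subtype.val, Subtype.val_injective⟩, fun {y z} => ?_⟩)
    exact ⟨fun h => ⟨y.2, z.2, h⟩, fun h => h.2.2⟩

theorem not_colorable_graphOfList {n : ℕ} {l : List (Fin n × Fin n)}
    (h : ∀ c : Fin n → Fin 3, ∃ p ∈ l, p.1 ≠ p.2 ∧ c p.1 = c p.2) :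
    ¬ (graphOfList l).Colorable 3 := by
  rintro ⟨c⟩
  obtain ⟨p, hp, hne, heq⟩ := h c
  exact c.valid (v := p.1) (w := p.2) ⟨hne, Or.inl hp⟩ heq

theorem containsSub_graphOfList {n m : ℕ} {l : List (Fin n × Fin n)} {u : Fin m → V}
    (hu : Function.Injective u) (σ : Fin n → Fin m) (hσ : Function.Injective σ)
    (h : ∀ p ∈ l, G.Adj (u (σ p.1)) (u (σ p.2))) : ContainsSub G (graphOfList l) := by
  refine ⟨⟨u ∘ σ, hu.comp hσ⟩, fun a b hab => ?_⟩
  rcases hab.2 with hl | hl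
  · exact h _ hl
  · exact (h _ hl).symm

end Criticality

theorem p5Free_graphW5 : P5Free graphW5 := by
  unfold graphW5
  exact p5Free_of_forall (by decide +kernel)

theorem p5Free_graphS1 : P5Free graphS1 := by
  unfold graphS1
  exact p5Free_of_forall (by decide +kernel)

theorem p5Free_graphS2 : P5Free graphS2 := by
  unfold graphS2
  exact p5Free_of_forall (by decide +kernel)

theorem not_colorable_graphW5 : ¬ graphW5.Colorable 3 :=
  not_colorable_graphOfList (by decide +kernel)

theorem not_colorable_graphS1 : ¬ graphS1.Colorable 3 :=
  not_colorable_graphOfList (by decide +kernel)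

theorem not_colorable_graphS2 : ¬ graphS2.Colorable 3 :=
  not_colorable_graphOfList (by decide +kernel)

theorem IsFiveHole.rotate {V : Type*} {G : SimpleGraph V} {v : Fin 5 → V} (hC : IsFiveHole G v)
    (k : Fin 5) : IsFiveHole G (fun i => v (i + k)) := by
  refine ⟨fun i j h => add_right_cancel (hC.1 h), fun i j => ?_⟩
  rw [hC.2]
  revert i j k
  decide

/-- A vertex seeing all of a 5-hole but at most one vertex forces one of `W5`, `S1`, `S2`. -/
theorem IsMN3P5.isoToSix_of_fiveHole {V : Type*} {G : SimpleGraph V} (hG : IsMN3P5 G)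
    {v : Fin 5 → V} (hC : IsFiveHole G v) {w : V} (hw : ∀ i, w ≠ v i)
    (hadj : ∀ i, i ≠ 0 → G.Adj w (v i)) : IsoToSix G := by
  have c : ∀ i j : Fin 5, (j = i + 1 ∨ i = j + 1) → G.Adj (v i) (v j) := fun i j => (hC.2 i j).2
  have n : ∀ i j : Fin 5, ¬ (j = i + 1 ∨ i = j + 1) → ¬ G.Adj (v i) (v j) :=
    fun i j => mt (hC.2 i j).1
  have c01 := c 0 1 (by decide)
  have c12 := c 1 2 (by decide)
  have c23 := c 2 3 (by decide)
  have c34 := c 3 4 (by decide)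
  have c40 := c 4 0 (by decide)
  have w1 := hadj 1 (by decide)
  have w2 := hadj 2 (by decide)
  have w3 := hadj 3 (by decide)
  have w4 := hadj 4 (by decide)
  by_cases w0 : G.Adj w (v 0)
  · have hu : Function.Injective (Fin.snoc v w : Fin 6 → V) :=
      Fin.snoc_injective_of_injective hC.1 (by simpa using fun i => (hw i).symm)
    refine Or.inr (Or.inl (hG.nonempty_iso p5Free_graphW5 not_colorable_graphW5
      (containsSub_graphOfList (u := ![v 0, v 1, v 2, v 3, v 4, w]) ?_ id
        Function.injective_id ?_)))
    · convert hu using 1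
      ext i
      fin_cases i <;> rfl
    · simp [c01, c12, c23, c34, c40, w0, w1, w2, w3, w4]
  obtain ⟨x, x0, hwx⟩ := hG.exists_adj_not_adj (hw 0).symm
  have hxv : ∀ i, x ≠ v i := by
    rintro i rfl
    by_cases hi : i = 0
    · exact G.irrefl (hi ▸ x0)
    · exact hwx (hadj i hi)
  have hxw : x ≠ w := by
    rintro rfl
    exact w0 x0.symm
  have hu : Function.Injective (Fin.snoc (Fin.snoc v w : Fin 6 → V) x : Fin 7 → V) := by
    refine Fin.snoc_injective_of_injective
      (Fin.snoc_injective_of_injective hC.1 (by simpa using fun i => (hw i).symm)) ?_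
    rintro ⟨i, hi⟩
    induction i using Fin.lastCases with
    | last => exact hxw (hi.symm.trans (Fin.snoc_last (α := fun _ => V) w v))
    | cast i => exact hxv i (by simpa using hi.symm)
  replace hu : Function.Injective ![v 0, v 1, v 2, v 3, v 4, w, x] := by
    convert hu using 1
    ext i
    fin_cases i <;> rfl
  have hS1 (h : ContainsSub G graphS1) : IsoToSix G :=
    Or.inr (Or.inr (Or.inl (hG.nonempty_iso p5Free_graphS1 not_colorable_graphS1 h)))
  have hS2 (h : ContainsSub G graphS2) : IsoToSix G :=
    Or.inr (Or.inr (Or.inr (Or.inl (hG.nonempty_iso p5Free_graphS2 not_colorable_graphS2 h))))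
  have c10 := c01.symm
  have c21 := c12.symm
  have c32 := c23.symm
  have c43 := c34.symm
  have c04 := c40.symm
  have w1' := w1.symm
  have w2' := w2.symm
  have w3' := w3.symm
  have w4' := w4.symm
  have x0' := x0.symm
  by_cases x34 : G.Adj x (v 3) ∧ G.Adj x (v 4)
  · exact hS1 (containsSub_graphOfList hu ![3, 2, 1, 0, 4, 5, 6] (by decide) (by simp [*]))
  by_cases x12 : G.Adj x (v 1) ∧ G.Adj x (v 2)
  · exact hS1 (containsSub_graphOfList hu ![2, 1, 0, 4, 3, 6, 5] (by decide) (by simp [*]))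
  by_cases x14 : G.Adj x (v 1) ∧ G.Adj x (v 4)
  · exact hS1 (containsSub_graphOfList hu ![1, 0, 4, 3, 2, 6, 5] (by decide) (by simp [*]))
  by_cases x23 : G.Adj x (v 2) ∧ G.Adj x (v 3)
  · exact hS2 (containsSub_graphOfList hu ![0, 1, 2, 3, 4, 5, 6] (by decide) (by simp [*]))
  have hx : (¬ G.Adj x (v 2) ∧ ¬ G.Adj x (v 4)) ∨ (¬ G.Adj x (v 1) ∧ ¬ G.Adj x (v 3)) := by
    tauto
  rcases hx with ⟨x2, x4⟩ | ⟨x1, x3⟩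
  · exact absurd (hasInducedP5_of_path w2' w4 c40 x0 (n 2 4 (by decide)) (n 2 0 (by decide))
      (fun h => x2 h.symm) w0 hwx (fun h => x4 h.symm)) hG.1
  · exact absurd (hasInducedP5_of_path w3' w1 c10 x0 (n 3 1 (by decide)) (n 3 0 (by decide))
      (fun h => x3 h.symm) w0 hwx (fun h => x1 h.symm)) hG.1

theorem mn3p5_five_hole_vertex_with_four_neighbors
    {V : Type*} [Fintype V] (G : SimpleGraph V) [DecidableRel G.Adj]
    (hG : IsMN3P5 G) (v : Fin 5 → V) (hC : IsFiveHole G v)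
    (w : V) (hw : ∀ i : Fin 5, w ≠ v i)
    (h4 : 4 ≤ (Finset.univ.filter (fun i : Fin 5 => G.Adj w (v i))).card) :
    IsoToSix G := by
  obtain ⟨k, hk⟩ : ∃ k : Fin 5, ∀ i, i ≠ k → G.Adj w (v i) := by
    by_cases hall : ∀ i, G.Adj w (v i)
    · exact ⟨0, fun i _ => hall i⟩
    push Not at hall
    obtain ⟨k, hk⟩ := hall
    refine ⟨k, fun i hik => by_contra fun hi => ?_⟩
    have hle := Finset.card_le_card (s := Finset.univ.filter fun i : Fin 5 => G.Adj w (v i))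
      (t := {k, i}ᶜ) fun j hj => by
        simp only [Finset.mem_filter_univ] at hj
        simp only [Finset.mem_compl, Finset.mem_insert, Finset.mem_singleton]
        rintro (rfl | rfl) <;> contradiction
    rw [Finset.card_compl, Finset.card_pair (Ne.symm hik), Fintype.card_fin] at hle
    omega
  exact hG.isoToSix_of_fiveHole (hC.rotate k) (fun i => hw (i + k))
    fun i hi => hk _ (by simpa using hi)
end

section
/- Let G be an MN3P5 graph with a dominating clique {a,b,c} of size 3, and set A = N(a) - {b,c}, B = N(b) - {a,c}, C = N(c) - {a,b}; suppose A, B and C are pairwise disjoint. Let X and Y be two distinct members of {A,B,C}, let X' be the vertex set of a connected component of the subgraph of G induced by X having at least two vertices, and let y be a vertex in Y. Then either y is adjacent to all vertices of X' or y is adjacent to no vertex of X'. -/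
open SimpleGraph

/-- The vertices of a path `v - w - x - y - z` without chords induce a `P5`. -/
theorem hasInducedP5_of_adj {V : Type*} {G : SimpleGraph V} {v w x y z : V}
    (hvw : G.Adj v w) (hwx : G.Adj w x) (hxy : G.Adj x y) (hyz : G.Adj y z)
    (hvx : ¬ G.Adj v x) (hvy : ¬ G.Adj v y) (hvz : ¬ G.Adj v z)
    (hwy : ¬ G.Adj w y) (hwz : ¬ G.Adj w z) (hxz : ¬ G.Adj x z) : HasInducedP5 G := by
  have hadj : ∀ i j : Fin 5, (pathGraph 5).Adj i j ↔
      G.Adj (![v, w, x, y, z] i) (![v, w, x, y, z] j) := by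
    intro i j
    fin_cases i <;> fin_cases j <;> simp [pathGraph_adj, *, G.adj_comm]
  refine ⟨⟨![v, w, x, y, z], fun i j hij => ?_⟩, hadj⟩
  have htwin : ∀ k, (pathGraph 5).Adj i k ↔ (pathGraph 5).Adj j k := fun k => by
    rw [hadj, hadj, hij]
  simp only [pathGraph_adj] at htwin
  clear hij hadj
  revert i j
  decide

/-- In a `P5`-free graph with an edge `pq`, a vertex adjacent to `p` but not to `q` does not
distinguish two adjacent vertices that are both nonadjacent to `p` and `q`. -/
theorem P5Free.adj_of_adj {V : Type*} {G : SimpleGraph V} (hG : P5Free G) {p q u v y : V}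
    (hpq : G.Adj p q) (hyp : G.Adj y p) (hyq : ¬ G.Adj y q)
    (hup : ¬ G.Adj u p) (huq : ¬ G.Adj u q) (hvp : ¬ G.Adj v p) (hvq : ¬ G.Adj v q)
    (huv : G.Adj u v) (hyu : G.Adj y u) : G.Adj y v := by
  by_contra hyv
  exact hG (hasInducedP5_of_adj huv.symm hyu.symm hyp hpq (fun h => hyv h.symm)
    hvp hvq hup huq hyq)

/-- In a `P5`-free graph with an edge `pq`, a vertex adjacent to `p` but not to `q` is complete or
anticomplete to each component of a set of vertices nonadjacent to `p` and `q`. -/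
theorem P5Free.component_all_or_none {V : Type*} {G : SimpleGraph V} (hG : P5Free G) {p q y : V}
    (hpq : G.Adj p q) (hyp : G.Adj y p) (hyq : ¬ G.Adj y q) {X : Set V}
    (hXp : ∀ x ∈ X, ¬ G.Adj x p) (hXq : ∀ x ∈ X, ¬ G.Adj x q)
    (comp : (G.induce X).ConnectedComponent) :
    (∀ x ∈ Subtype.val '' comp.supp, G.Adj y x) ∨
      (∀ x ∈ Subtype.val '' comp.supp, ¬ G.Adj y x) := by
  have hwalk : ∀ u v : X, (G.induce X).Walk u v → G.Adj y u → G.Adj y v := by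
    intro u v w
    induction w with
    | nil => exact id
    | @cons u v _ huv _ ih =>
      exact fun hyu => ih (hG.adj_of_adj hpq hyp hyq (hXp u u.2) (hXq u u.2)
        (hXp v v.2) (hXq v v.2) huv hyu)
  by_cases h : ∃ x ∈ Subtype.val '' comp.supp, G.Adj y x
  · obtain ⟨_, ⟨u, hu, rfl⟩, hyu⟩ := h
    left
    rintro _ ⟨v, hv, rfl⟩
    obtain ⟨w⟩ := ConnectedComponent.exact (hu.trans hv.symm)
    exact hwalk u v w hyu
  · right
    exact fun x hx hyx => h ⟨x, hx, hyx⟩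

theorem component_neighbor_all_or_none
    {V : Type*} [Fintype V] (G : SimpleGraph V) (hG : IsMN3P5 G)
    (a b c : V) (hdom : IsDomClique3 G a b c)
    (A B C : Set V)
    (hA : A = G.neighborSet a \ {b, c})
    (hB : B = G.neighborSet b \ {a, c})
    (hC : C = G.neighborSet c \ {a, b})
    (hAB : Disjoint A B) (hAC : Disjoint A C) (hBC : Disjoint B C)
    (X Y : Set V) (hX : X ∈ ({A, B, C} : Set (Set V))) (hY : Y ∈ ({A, B, C} : Set (Set V)))
    (hXY : X ≠ Y)
    (comp : (G.induce X).ConnectedComponent)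
    (X' : Set V) (hX' : X' = Subtype.val '' comp.supp)
    (htwo : ∃ x y, x ∈ X' ∧ y ∈ X' ∧ x ≠ y)
    (y : V) (hy : y ∈ Y) :
    (∀ x ∈ X', G.Adj y x) ∨ (∀ x ∈ X', ¬ G.Adj y x) := by
  obtain ⟨-, -, -, hab, hac, hbc, -⟩ := hdom
  have key : ∀ x,
      (x ∈ A → G.Adj x a ∧ ¬ G.Adj x b ∧ ¬ G.Adj x c) ∧
      (x ∈ B → G.Adj x b ∧ ¬ G.Adj x a ∧ ¬ G.Adj x c) ∧
      (x ∈ C → G.Adj x c ∧ ¬ G.Adj x a ∧ ¬ G.Adj x b) := by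
    intro x
    simp only [Set.disjoint_left] at hAB hAC hBC
    have := G.adj_comm x a
    have := G.adj_comm x b
    have := G.adj_comm x c
    have := G.irrefl (v := x)
    grind [mem_neighborSet]
  have hG5 := hG.1
  subst hX'
  rcases hX with rfl | rfl | rfl <;> rcases hY with rfl | rfl | rfl <;>
    try exact absurd rfl hXY
  · exact hG5.component_all_or_none hbc ((key y).2.1 hy).1 ((key y).2.1 hy).2.2
      (fun x hx => ((key x).1 hx).2.1) (fun x hx => ((key x).1 hx).2.2) comp
  · exact hG5.component_all_or_none hbc.symm ((key y).2.2 hy).1 ((key y).2.2 hy).2.2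
      (fun x hx => ((key x).1 hx).2.2) (fun x hx => ((key x).1 hx).2.1) comp
  · exact hG5.component_all_or_none hac ((key y).1 hy).1 ((key y).1 hy).2.2
      (fun x hx => ((key x).2.1 hx).2.1) (fun x hx => ((key x).2.1 hx).2.2) comp
  · exact hG5.component_all_or_none hac.symm ((key y).2.2 hy).1 ((key y).2.2 hy).2.1
      (fun x hx => ((key x).2.1 hx).2.2) (fun x hx => ((key x).2.1 hx).2.1) comp
  · exact hG5.component_all_or_none hab ((key y).1 hy).1 ((key y).1 hy).2.1
      (fun x hx => ((key x).2.2 hx).2.1) (fun x hx => ((key x).2.2 hx).2.2) comp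
  · exact hG5.component_all_or_none hab.symm ((key y).2.1 hy).1 ((key y).2.1 hy).2.1
      (fun x hx => ((key x).2.2 hx).2.2) (fun x hx => ((key x).2.2 hx).2.1) comp
end

section
/- Let G be an MN3P5 graph with a dominating clique {a,b,c} of size 3, and set A = N(a) - {b,c}, B = N(b) - {a,c}, C = N(c) - {a,b}; suppose A, B and C are pairwise disjoint. Then every connected component of the subgraph of G induced by A (and likewise by B or by C) is a single vertex or a single edge. -/
open SimpleGraph

/-- Distinct vertices joined exactly as in a path on five vertices form an induced `P5`. -/
lemma hasInducedP5_of_path_s10 {V : Type*} {G : SimpleGraph V} {p q r s t : V}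
    (hpq : G.Adj p q) (hqr : G.Adj q r) (hrs : G.Adj r s) (hst : G.Adj s t)
    (hpr : ¬ G.Adj p r) (hps : ¬ G.Adj p s) (hpt : ¬ G.Adj p t)
    (hqs : ¬ G.Adj q s) (hqt : ¬ G.Adj q t) (hrt : ¬ G.Adj r t) : HasInducedP5 G := by
  have hadj : ∀ i j : Fin 5, (SimpleGraph.pathGraph 5).Adj i j ↔
      G.Adj (![p, q, r, s, t] i) (![p, q, r, s, t] j) := by
    intro i j
    rw [SimpleGraph.pathGraph_adj]
    fin_cases i <;> fin_cases j <;> simp [*, G.adj_comm]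
  have hinj : Function.Injective ![p, q, r, s, t] := by
    intro i j hij
    have key : ∀ k, (SimpleGraph.pathGraph 5).Adj i k ↔ (SimpleGraph.pathGraph 5).Adj j k := by
      intro k
      rw [hadj, hadj, hij]
    simp only [SimpleGraph.pathGraph_adj] at key
    clear hij hadj
    revert i j
    decide
  exact ⟨⟨_, hinj⟩, hadj⟩

/-- Every proper induced subgraph of an MN3P5 graph is 3-colorable. -/
lemma IsMN3P5.colorable_induce {V : Type*} {G : SimpleGraph V} (hG : IsMN3P5 G)
    {S : Set V} {v : V} (hv : v ∉ S) : (G.induce S).Colorable 3 := by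
  have hH : (⊤ : G.Subgraph).induce S ≠ ⊤ := by
    intro h
    have hverts := congrArg Subgraph.verts h
    exact hv (by simp at hverts; simp [hverts])
  rcases hG.2.2 _ hH with h | ⟨f, hf⟩
  · obtain ⟨col⟩ := h
    refine ⟨Coloring.mk (fun x => col ⟨x.1, x.2⟩) ?_⟩
    intro x y hxy
    refine col.valid ?_
    simpa using hxy
  · refine absurd ⟨f.trans ⟨_, Subtype.val_injective⟩, fun i j => ?_⟩ hG.1
    have hi : (f i).1 ∈ S := (f i).2
    have hj : (f j).1 ∈ S := (f j).2
    rw [hf]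
    simp [hi, hj]

/-- In an MN3P5 graph, a homogeneous set `K` which contains an edge and lies in the neighborhood of
a vertex `a` consists of the ends of that edge, provided some vertex other than `a` is not in
`K`. -/
lemma IsMN3P5.homogeneous_subset_edge {V : Type*} {G : SimpleGraph V} (hG : IsMN3P5 G)
    {K : Set V} {a b u v : V} (hKa : ∀ t ∈ K, G.Adj a t) (hba : b ≠ a) (hbK : b ∉ K)
    (hu : u ∈ K) (hv : v ∈ K) (huv : G.Adj u v)
    (hmod : ∀ t ∈ K, ∀ s ∉ K, G.Adj t s → ∀ r ∈ K, G.Adj r s) :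
    ∀ w ∈ K, w = u ∨ w = v := by
  classical
  by_contra! hw
  obtain ⟨w, hwK, hwu, hwv⟩ := hw
  obtain ⟨f⟩ := hG.colorable_induce (S := {t | t ∈ K → t = u ∨ t = v}) (v := w)
    (by simp [hwK, hwu, hwv])
  obtain ⟨g⟩ := hG.colorable_induce (S := insert a K) (v := b) (by simp [hba, hbK])
  have hf : ∀ s t (hs : s ∈ K → s = u ∨ s = v) (ht : t ∈ K → t = u ∨ t = v),
      G.Adj s t → f ⟨s, hs⟩ ≠ f ⟨t, ht⟩ := fun s t hs ht h => f.valid (by simpa using h)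
  have hg : ∀ s t (hs : s ∈ insert a K) (ht : t ∈ insert a K),
      G.Adj s t → g ⟨s, hs⟩ ≠ g ⟨t, ht⟩ := fun s t hs ht h => g.valid (by simpa using h)
  have hfuv := hf u v (fun _ => Or.inl rfl) (fun _ => Or.inr rfl) huv
  apply hG.2.1
  let col : V → Fin 3 := fun t =>
    if ht : t ∈ K then
      if g ⟨t, Or.inr ht⟩ = g ⟨u, Or.inr hu⟩ then f ⟨u, fun _ => Or.inl rfl⟩
      else f ⟨v, fun _ => Or.inr rfl⟩
    else f ⟨t, fun h => absurd h ht⟩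
  have hmixed : ∀ s t, s ∈ K → t ∉ K → G.Adj s t → col s ≠ col t := by
    intro s t hs ht hst
    have h1 := hf u t (fun _ => Or.inl rfl) (fun h => absurd h ht) (hmod s hs t ht hst u hu)
    have h2 := hf v t (fun _ => Or.inr rfl) (fun h => absurd h ht) (hmod s hs t ht hst v hv)
    simp only [col, hs, ht, dif_pos, dif_neg, not_false_eq_true]
    split_ifs <;> assumption
  refine ⟨Coloring.mk col ?_⟩
  intro s t hst
  by_cases hs : s ∈ K <;> by_cases ht : t ∈ K
  · have h1 := hg s t (Or.inr hs) (Or.inr ht) hst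
    have h2 := hg a s (Or.inl rfl) (Or.inr hs) (hKa s hs)
    have h3 := hg a t (Or.inl rfl) (Or.inr ht) (hKa t ht)
    have h4 := hg a u (Or.inl rfl) (Or.inr hu) (hKa u hu)
    simp only [col, hs, ht, dif_pos]
    split_ifs with h5 h6 h6
    · exact absurd (h5.trans h6.symm) h1
    · exact hfuv
    · exact hfuv.symm
    · omega
  · exact hmixed s t hs ht hst
  · exact (hmixed t s ht hs hst.symm).symm
  · simp only [col, hs, ht, dif_neg, not_false_eq_true]
    exact hf s t _ _ hst

/-- In a `P5`-free graph with an edge `b, c`, a neighbor `w` of `b` outside the neighborhood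
of `c` which is adjacent to a vertex of a connected set anticomplete to `b` and `c` is
adjacent to all of that set. -/
lemma P5Free.adj_of_reachable {V : Type*} {G : SimpleGraph V} (hG : P5Free G) {A : Set V}
    {b c w : V} (hbc : G.Adj b c) (hAb : ∀ t ∈ A, ¬ G.Adj t b) (hAc : ∀ t ∈ A, ¬ G.Adj t c)
    (hwb : G.Adj w b) (hwc : ¬ G.Adj w c) {s t : A} (hst : (G.induce A).Reachable s t)
    (hs : G.Adj s w) : G.Adj t w := by
  obtain ⟨p⟩ := hst
  induction p with
  | nil => exact hs
  | @cons s q t hsq _ ih =>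
    refine ih ?_
    by_contra hq
    have hqs : G.Adj q s := by simpa using hsq.symm
    exact hG (hasInducedP5_of_path_s10 hqs hs hwb hbc hq (hAb _ q.2) (hAc _ q.2) (hAb _ s.2)
      (hAc _ s.2) hwc)

/-- If a triangle dominates an MN3P5 graph and its vertices have no further common neighbors, then
the components of the private neighborhood of one of them are single vertices or single edges. -/
lemma IsMN3P5.component_neighborSet {V : Type*} {G : SimpleGraph V} (hG : IsMN3P5 G)
    {a b c : V} (hdom : IsDomClique3 G a b c)
    (hab : ∀ t, t ≠ c → G.Adj a t → ¬ G.Adj b t) (hac : ∀ t, t ≠ b → G.Adj a t → ¬ G.Adj c t)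
    (hbc : ∀ t, t ≠ a → G.Adj b t → ¬ G.Adj c t)
    {A : Set V} (hA : A = G.neighborSet a \ {b, c}) (comp : (G.induce A).ConnectedComponent) :
    (∃ x, comp.supp = {x}) ∨
    (∃ x y, x ≠ y ∧ (G.induce A).Adj x y ∧ comp.supp = {x, y}) := by
  obtain ⟨nab, nac, nbc, eab, eac, ebc, hd⟩ := hdom
  have hmem : ∀ t, t ∈ A ↔ G.Adj a t ∧ t ≠ b ∧ t ≠ c := by simp [hA]
  have hAa : ∀ t ∈ A, G.Adj a t := fun t ht => ((hmem t).1 ht).1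
  have hAb : ∀ t ∈ A, ¬ G.Adj t b := fun t ht h => hab t ((hmem t).1 ht).2.2 (hAa t ht) h.symm
  have hAc : ∀ t ∈ A, ¬ G.Adj t c := fun t ht h => hac t ((hmem t).1 ht).2.1 (hAa t ht) h.symm
  induction comp using ConnectedComponent.ind with | _ u
  by_cases hsingle : ((G.induce A).connectedComponentMk u).supp = {u}
  · exact Or.inl ⟨u, hsingle⟩
  right
  have hex : ∃ v, (G.induce A).Adj u v := by
    by_contra! hno
    refine hsingle (Set.eq_singleton_iff_unique_mem.2 ⟨rfl, fun t ht => ?_⟩)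
    obtain ⟨p⟩ := (ConnectedComponent.exact ht).symm
    cases p with
    | nil => rfl
    | cons h _ => exact absurd h (hno _)
  obtain ⟨v, huv⟩ := hex
  let K : Set V := {t | ∃ h : t ∈ A, (G.induce A).Reachable u ⟨t, h⟩}
  have hsub := hG.homogeneous_subset_edge (K := K) (a := a) (b := b) (u := u) (v := v)
    (fun t ht => hAa t ht.1) nab.symm (fun h => ((hmem b).1 h.1).2.1 rfl) ⟨u.2, Reachable.refl _⟩
    ⟨v.2, huv.reachable⟩ (by simpa using huv) (by
      rintro t ⟨htA, ht⟩ s hs hts r ⟨hrA, hr⟩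
      have htr := ht.symm.trans hr
      by_cases hsa : s = a
      · exact hsa ▸ (hAa r hrA).symm
      have hsb : s ≠ b := fun h => hAb t htA (h ▸ hts)
      have hsc : s ≠ c := fun h => hAc t htA (h ▸ hts)
      rcases hd s hsa hsb hsc with h | h | h
      · have hsA : s ∈ A := (hmem s).2 ⟨h.symm, hsb, hsc⟩
        refine absurd ⟨hsA, ht.trans (Adj.reachable ?_)⟩ hs
        simpa using hts
      · exact hG.1.adj_of_reachable ebc hAb hAc h
          (fun h' => hbc s hsa h.symm h'.symm) htr hts
      · exact hG.1.adj_of_reachable ebc.symm hAc hAb h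
          (fun h' => hbc s hsa h'.symm h.symm) htr hts)
  refine ⟨u, v, huv.ne, huv, Set.ext fun t => ⟨fun ht => ?_, ?_⟩⟩
  · rcases hsub t ⟨t.2, (ConnectedComponent.exact ht).symm⟩ with h | h
    · exact Or.inl (Subtype.ext h)
    · exact Or.inr (Subtype.ext h)
  · rintro (rfl | rfl)
    · rfl
    · exact ConnectedComponent.sound huv.reachable.symm

theorem component_single_vertex_or_edge
    {V : Type*} [Fintype V] (G : SimpleGraph V) (hG : IsMN3P5 G)
    (a b c : V) (hdom : IsDomClique3 G a b c)
    (A B C : Set V)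
    (hA : A = G.neighborSet a \ {b, c})
    (hB : B = G.neighborSet b \ {a, c})
    (hC : C = G.neighborSet c \ {a, b})
    (hAB : Disjoint A B) (hAC : Disjoint A C) (hBC : Disjoint B C)
    (X : Set V) (hX : X ∈ ({A, B, C} : Set (Set V)))
    (comp : (G.induce X).ConnectedComponent) :
    (∃ x : X, comp.supp = {x}) ∨
    (∃ x y : X, x ≠ y ∧ (G.induce X).Adj x y ∧ comp.supp = {x, y}) := by
  have hdom' := hdom
  obtain ⟨nab, nac, nbc, eab, eac, ebc, hd⟩ := hdom'
  subst hA hB hC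
  have hab : ∀ t, t ≠ c → G.Adj a t → ¬ G.Adj b t := fun t ht h h' =>
    Set.disjoint_left.1 hAB ⟨h, by simp [ht, h'.ne']⟩ ⟨h', by simp [ht, h.ne']⟩
  have hac : ∀ t, t ≠ b → G.Adj a t → ¬ G.Adj c t := fun t ht h h' =>
    Set.disjoint_left.1 hAC ⟨h, by simp [ht, h'.ne']⟩ ⟨h', by simp [ht, h.ne']⟩
  have hbc : ∀ t, t ≠ a → G.Adj b t → ¬ G.Adj c t := fun t ht h h' =>
    Set.disjoint_left.1 hBC ⟨h, by simp [ht, h'.ne']⟩ ⟨h', by simp [ht, h.ne']⟩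
  rcases hX with rfl | rfl | rfl
  · exact hG.component_neighborSet hdom hab hac hbc rfl comp
  · exact hG.component_neighborSet
      ⟨nab.symm, nbc, nac, eab.symm, ebc, eac, fun x h1 h2 h3 => or_left_comm.1 (hd x h2 h1 h3)⟩
      (fun t ht h h' => hab t ht h' h) hbc hac rfl comp
  · exact hG.component_neighborSet
      ⟨nac.symm, nbc.symm, nab, eac.symm, ebc.symm, eab,
        fun x h1 h2 h3 => or_comm.1 (or_assoc.2 (hd x h2 h3 h1))⟩
      (fun t ht h h' => hac t ht h' h) (fun t ht h h' => hbc t ht h' h) hab rfl comp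
end
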